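/- arXiv:1810.05510 — 6 statements merged into one kernel-verified Lean document; each statement's English description precedes it below -/
import Mathlib

section
/- Let q > 0, n̄ > 0 and C ≥ 0 be real constants. The function g : ℝ → ℝ defined by g(b) = q·b + q·(1 − b)·(1 − exp(−n̄·b))·C is concave on the interval [0,1], and it is strictly concave on [0,1] whenever C > 0. -/
theorem hasDerivAt_offloadingGain (q n C b : ℝ) :
    HasDerivAt (fun b : ℝ => q * b + q * (1 - b) * (1 - Real.exp (-n * b)) * C)
      (q + q * C * (n * (1 - b) * Real.exp (-n * b) - (1 - Real.exp (-n * b)))) b := by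
  have hexp := ((hasDerivAt_id' b).const_mul (-n)).exp
  have hlin := ((hasDerivAt_id' b).const_sub 1).const_mul q
  refine (((hasDerivAt_id' b).const_mul q).add
    ((hlin.mul (hexp.const_sub 1)).mul_const C)).congr_deriv ?_
  ring

theorem hasDerivAt_deriv_offloadingGain (q n C b : ℝ) :
    HasDerivAt
      (fun b : ℝ => q + q * C * (n * (1 - b) * Real.exp (-n * b) - (1 - Real.exp (-n * b))))
      (-(q * C * n * Real.exp (-n * b) * (2 + n * (1 - b)))) b := by
  have hexp := ((hasDerivAt_id' b).const_mul (-n)).exp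
  have hlin := ((hasDerivAt_id' b).const_sub 1).const_mul n
  refine ((((hlin.mul hexp).sub (hexp.const_sub 1)).const_mul (q * C)).const_add q).congr_deriv ?_
  ring

theorem strictConcaveOn_offloadingGain {q n C : ℝ} (hq : 0 < q) (hn : 0 < n) (hC : 0 < C) :
    StrictConcaveOn ℝ (Set.Icc (0 : ℝ) 1)
      (fun b : ℝ => q * b + q * (1 - b) * (1 - Real.exp (-n * b)) * C) := by
  refine strictConcaveOn_of_deriv2_neg' (convex_Icc 0 1)
    (fun b _ => (hasDerivAt_offloadingGain q n C b).continuousAt.continuousWithinAt) fun b hb => ?_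
  rw [Function.iterate_succ_apply, Function.iterate_one,
    funext fun x => (hasDerivAt_offloadingGain q n C x).deriv,
    (hasDerivAt_deriv_offloadingGain q n C b).deriv, neg_lt_zero]
  have : 0 ≤ 1 - b := sub_nonneg.2 hb.2
  positivity

/-- The per-file offloading gain contribution `g(b) = q·b + q·(1−b)·(1−exp(−n̄·b))·C`
is concave on `[0,1]`, and strictly concave there whenever `C > 0`. -/
theorem stmt_0 (q nbar C : ℝ) (hq : 0 < q) (hn : 0 < nbar) (hC : 0 ≤ C) :
    ConcaveOn ℝ (Set.Icc (0:ℝ) 1)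
      (fun b : ℝ => q * b + q * (1 - b) * (1 - Real.exp (-nbar * b)) * C) ∧
    (0 < C → StrictConcaveOn ℝ (Set.Icc (0:ℝ) 1)
      (fun b : ℝ => q * b + q * (1 - b) * (1 - Real.exp (-nbar * b)) * C)) := by
  refine ⟨?_, strictConcaveOn_offloadingGain hq hn⟩
  rcases hC.eq_or_lt with rfl | hC
  · simpa using (concaveOn_id (𝕜 := ℝ) (convex_Icc (0 : ℝ) 1)).smul hq.le
  · exact (strictConcaveOn_offloadingGain hq hn hC).concaveOn
end

section
/- Let N be a positive integer, n̄ > 0, C ≥ 0, and q₁,…,q_N ≥ 0. The offloading gain P_o : ℝ^N → ℝ defined by P_o(b) = Σ_{i=1}^{N} [ q_i·b_i + q_i·(1 − b_i)·(1 − exp(−n̄·b_i))·C ] is concave on the box [0,1]^N. -/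
/-- On `[0, 1]` the product of the nonnegative, decreasing, convex functions `1 - x` and
`exp (-n x)` is convex. -/
lemma convexOn_one_sub_mul_exp_neg (n : ℝ) (hn : 0 ≤ n) :
    ConvexOn ℝ (Set.Icc (0:ℝ) 1) (fun x => (1 - x) * Real.exp (-n * x)) := by
  have h1 : ConvexOn ℝ (Set.Icc (0:ℝ) 1) (fun x : ℝ => 1 - x) :=
    (convexOn_const (1:ℝ) (convex_Icc 0 1)).sub (concaveOn_id (convex_Icc 0 1))
  have h2 : ConvexOn ℝ (Set.Icc (0:ℝ) 1) (fun x : ℝ => Real.exp (-n * x)) :=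
    (convexOn_exp.comp_linearMap (LinearMap.mulLeft ℝ (-n))).subset
      (Set.subset_univ _) (convex_Icc 0 1)
  refine h1.mul h2 (fun x hx => sub_nonneg.2 hx.2) (fun x _ => (Real.exp_pos _).le) ?_
  have a1 : AntitoneOn (fun x : ℝ => 1 - x) (Set.Icc (0:ℝ) 1) :=
    fun x _ y _ hxy => sub_le_sub_left hxy 1
  have a2 : AntitoneOn (fun x : ℝ => Real.exp (-n * x)) (Set.Icc (0:ℝ) 1) :=
    fun x _ y _ hxy => Real.exp_le_exp.2 (by nlinarith)
  exact a1.monovaryOn a2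

/-- The offloading gain `P_o(b) = Σ_i [q_i·b_i + q_i·(1−b_i)·(1−exp(−n̄·b_i))·C]`
is concave on the box `[0,1]^N`. -/
theorem stmt_2 (N : ℕ) (hN : 0 < N) (nbar C : ℝ) (hn : 0 < nbar) (hC : 0 ≤ C)
    (q : Fin N → ℝ) (hq : ∀ i, 0 ≤ q i) :
    ConcaveOn ℝ {b : Fin N → ℝ | ∀ i, b i ∈ Set.Icc (0:ℝ) 1}
      (fun b : Fin N → ℝ =>
        ∑ i, (q i * b i + q i * (1 - b i) * (1 - Real.exp (-nbar * b i)) * C)) := by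
  have hconv := convexOn_one_sub_mul_exp_neg nbar hn.le
  refine ⟨fun x hx y hy a b ha hb hab i => convex_Icc (0:ℝ) 1 (hx i) (hy i) ha hb hab, ?_⟩
  intro x hx y hy a b ha hb hab
  simp only [smul_eq_mul, Finset.mul_sum, ← Finset.sum_add_distrib]
  refine Finset.sum_le_sum fun i _ => ?_
  have h := mul_le_mul_of_nonneg_left (hconv.2 (hx i) (hy i) ha hb hab)
    (mul_nonneg (hq i) hC)
  simp only [smul_eq_mul, Pi.add_apply, Pi.smul_apply] at h ⊢
  obtain rfl : b = 1 - a := by linarith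
  linear_combination h
end

section
/- Let N be a positive integer, n̄ > 0, C > 0, q₁,…,q_N > 0, and let M be a real number with 0 ≤ M ≤ N. For each i define h_i(b) = q_i + q_i·C·( n̄·(1 − b)·exp(−n̄·b) − (1 − exp(−n̄·b)) ). Suppose b* ∈ [0,1]^N satisfies Σ_{i=1}^N b*_i = M, and there exists v* ∈ ℝ such that for every i: (i) if b*_i = 1 then v* ≤ q_i − q_i(1 − e^{−n̄})C; (ii) if b*_i = 0 then v* ≥ q_i + n̄·q_i·C; (iii) if 0 < b*_i < 1 then v* = h_i(b*_i). Then b* is a global maximizer of the offloading gain P_o(b) = Σ_{i=1}^{N} [ q_i·b_i + q_i·(1 − b_i)·(1 − exp(−n̄·b_i))·C ] over the feasible set {b ∈ ℝ^N : 0 ≤ b_i ≤ 1 for all i, Σ_{i=1}^N b_i = M}. -/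
/-- The concave function `y ↦ (1 - y) (1 - exp (-n y))` lies below its tangent lines on
`(-∞, 1]`. -/
theorem one_sub_mul_one_sub_exp_le_tangent {n x y : ℝ} (hn : 0 < n) (hy : y ≤ 1) :
    (1 - y) * (1 - Real.exp (-n * y)) ≤ (1 - x) * (1 - Real.exp (-n * x)) +
      (n * (1 - x) * Real.exp (-n * x) - (1 - Real.exp (-n * x))) * (y - x) := by
  have hexp : Real.exp (-n * x) * (1 - n * (y - x)) ≤ Real.exp (-n * y) := by
    have hsplit : Real.exp (-n * y) = Real.exp (-n * x) * Real.exp (-n * (y - x)) := by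
      rw [← Real.exp_add]
      ring_nf
    rw [hsplit]
    refine mul_le_mul_of_nonneg_left ?_ (Real.exp_pos _).le
    linarith [Real.add_one_le_exp (-n * (y - x))]
  have hmul := mul_le_mul_of_nonneg_left hexp (sub_nonneg.2 hy)
  have hsq : 0 ≤ Real.exp (-n * x) * n * (y - x) ^ 2 := by positivity
  linarith


/-- KKT sufficiency for the offloading-gain maximization problem: if `b*` is feasible
(`Σ b*_i = M`, `b* ∈ [0,1]^N`) and there is a multiplier `v*` satisfying the stated
conditions with respect to the partial derivatives
`h_i(b) = q_i + q_i·C·(n̄·(1−b)·exp(−n̄·b) − (1 − exp(−n̄·b)))`,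
then `b*` globally maximizes the offloading gain over the feasible set. -/
theorem stmt_3 (N : ℕ) (hN : 0 < N) (nbar C : ℝ) (hn : 0 < nbar) (hC : 0 < C)
    (q : Fin N → ℝ) (hq : ∀ i, 0 < q i) (M : ℝ) (hM0 : 0 ≤ M) (hMN : M ≤ (N : ℝ))
    (bstar : Fin N → ℝ) (hbstar : ∀ i, bstar i ∈ Set.Icc (0:ℝ) 1)
    (hsum : ∑ i, bstar i = M) (vstar : ℝ)
    (h1 : ∀ i, bstar i = 1 → vstar ≤ q i - q i * (1 - Real.exp (-nbar)) * C)
    (h0 : ∀ i, bstar i = 0 → vstar ≥ q i + nbar * q i * C)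
    (hmid : ∀ i, 0 < bstar i → bstar i < 1 →
      vstar = q i + q i * C * (nbar * (1 - bstar i) * Real.exp (-nbar * bstar i)
        - (1 - Real.exp (-nbar * bstar i)))) :
    ∀ b : Fin N → ℝ, (∀ i, 0 ≤ b i ∧ b i ≤ 1) → ∑ i, b i = M →
      ∑ i, (q i * b i + q i * (1 - b i) * (1 - Real.exp (-nbar * b i)) * C)
        ≤ ∑ i, (q i * bstar i + q i * (1 - bstar i) * (1 - Real.exp (-nbar * bstar i)) * C) := by
  intro b hb hbsum
  have hterm : ∀ i, q i * b i + q i * (1 - b i) * (1 - Real.exp (-nbar * b i)) * C ≤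
      q i * bstar i + q i * (1 - bstar i) * (1 - Real.exp (-nbar * bstar i)) * C +
        vstar * (b i - bstar i) := by
    intro i
    have htangent := mul_le_mul_of_nonneg_left
      (one_sub_mul_one_sub_exp_le_tangent (x := bstar i) hn (hb i).2) (mul_pos (hq i) hC).le
    have hslope : (q i + q i * C * (nbar * (1 - bstar i) * Real.exp (-nbar * bstar i)
        - (1 - Real.exp (-nbar * bstar i)))) * (b i - bstar i) ≤ vstar * (b i - bstar i) := by
      rcases (hbstar i).1.eq_or_lt with hzero | hpos
      · have hv := h0 i hzero.symm
        refine mul_le_mul_of_nonneg_right ?_ (by linarith [(hb i).1])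
        rw [← hzero, mul_zero, Real.exp_zero]
        linarith
      rcases (hbstar i).2.eq_or_lt with hone | hlt
      · have hv := h1 i hone
        refine mul_le_mul_of_nonpos_right ?_ (by linarith [(hb i).2])
        rw [hone, mul_one]
        linarith
      · rw [← hmid i hpos hlt]
    linarith
  calc
    _ ≤ ∑ i, (q i * bstar i + q i * (1 - bstar i) * (1 - Real.exp (-nbar * bstar i)) * C +
        vstar * (b i - bstar i)) := Finset.sum_le_sum fun i _ => hterm i
    _ = _ := by
      rw [Finset.sum_add_distrib, ← Finset.mul_sum, Finset.sum_sub_distrib, hbsum, hsum]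
      ring
end

section
/- Let N be a positive integer, n̄ > 0, C > 0, and q₁,…,q_N > 0. The offloading gain P_o(b) = Σ_{i=1}^{N} [ q_i·b_i + q_i·(1 − b_i)·(1 − exp(−n̄·b_i))·C ] is strictly concave on [0,1]^N; consequently, for any real M with 0 ≤ M ≤ N, P_o has at most one maximizer over the feasible set {b ∈ [0,1]^N : Σ_{i=1}^N b_i = M}. -/
/-- A separable sum of strictly concave functions of one real variable is strictly concave
on the product of the domains. -/
theorem strictConcaveOn_sum_pi {ι : Type*} [Fintype ι] {s : ι → Set ℝ} {f : ι → ℝ → ℝ}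
    (hf : ∀ i, StrictConcaveOn ℝ (s i) (f i)) :
    StrictConcaveOn ℝ {x : ι → ℝ | ∀ i, x i ∈ s i} (fun x => ∑ i, f i (x i)) := by
  refine ⟨fun x hx y hy a b ha hb hab i => (hf i).1 (hx i) (hy i) ha hb hab, ?_⟩
  intro x hx y hy hxy a b ha hb hab
  obtain ⟨j, hj⟩ := Function.ne_iff.mp hxy
  simp only [smul_eq_mul, Finset.mul_sum, ← Finset.sum_add_distrib]
  refine Finset.sum_lt_sum (fun i _ => ?_) ⟨j, Finset.mem_univ j, ?_⟩
  · exact (hf i).concaveOn.2 (hx i) (hy i) ha.le hb.le hab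
  · exact (hf j).2 (hx j) (hy j) hj ha hb hab

/-- The contribution of a single file to the offloading gain is strictly concave
in its caching probability. -/
theorem strictConcaveOn_fileGain {q n C : ℝ} (hq : 0 < q) (hn : 0 < n) (hC : 0 < C) :
    StrictConcaveOn ℝ (Set.Icc 0 1)
      (fun x : ℝ => q * x + q * (1 - x) * (1 - Real.exp (-n * x)) * C) := by
  have hexp (x : ℝ) : HasDerivAt (fun x => Real.exp (-n * x)) (Real.exp (-n * x) * -n) x := by
    simpa using ((hasDerivAt_id x).const_mul (-n)).exp
  have hsub (x : ℝ) : HasDerivAt (fun x : ℝ => 1 - x) (-1) x := by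
    simpa using (hasDerivAt_id x).const_sub 1
  have h₁ : deriv (fun x : ℝ => q * x + q * (1 - x) * (1 - Real.exp (-n * x)) * C) =
      fun x => q + q * C * ((1 - x) * n * Real.exp (-n * x) - (1 - Real.exp (-n * x))) := by
    funext x
    refine HasDerivAt.deriv ?_
    convert ((hasDerivAt_id' x).const_mul q).fun_add
      ((((hsub x).const_mul q).fun_mul ((hexp x).const_sub 1)).mul_const C) using 1
    ring
  have h₂ (x : ℝ) : HasDerivAt
      (fun x => q + q * C * ((1 - x) * n * Real.exp (-n * x) - (1 - Real.exp (-n * x))))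
      (-(q * C * n * Real.exp (-n * x) * (2 + n * (1 - x)))) x := by
    refine ((((((hsub x).mul_const n).fun_mul (hexp x)).fun_sub
      ((hexp x).const_sub 1)).const_mul (q * C)).const_add q).congr_deriv ?_
    ring
  refine strictConcaveOn_of_deriv2_neg' (convex_Icc 0 1) (by fun_prop) fun x hx => ?_
  rw [Function.iterate_succ, Function.iterate_one, Function.comp_apply, h₁, (h₂ x).deriv,
    neg_lt_zero]
  have : 0 ≤ 1 - x := sub_nonneg.mpr hx.2
  positivity


/-- The offloading gain is strictly concave on `[0,1]^N`; consequently, for any cache size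
`M` with `0 ≤ M ≤ N`, it has at most one maximizer over the feasible set
`{b ∈ [0,1]^N : Σ b_i = M}`. -/
theorem stmt_4 (N : ℕ) (hN : 0 < N) (nbar C : ℝ) (hn : 0 < nbar) (hC : 0 < C)
    (q : Fin N → ℝ) (hq : ∀ i, 0 < q i) :
    StrictConcaveOn ℝ {b : Fin N → ℝ | ∀ i, b i ∈ Set.Icc (0:ℝ) 1}
      (fun b : Fin N → ℝ =>
        ∑ i, (q i * b i + q i * (1 - b i) * (1 - Real.exp (-nbar * b i)) * C)) ∧
    ∀ M : ℝ, 0 ≤ M → M ≤ (N : ℝ) →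
      ∀ b₁ b₂ : Fin N → ℝ,
        ((∀ i, b₁ i ∈ Set.Icc (0:ℝ) 1) ∧ ∑ i, b₁ i = M) →
        ((∀ i, b₂ i ∈ Set.Icc (0:ℝ) 1) ∧ ∑ i, b₂ i = M) →
        (∀ b : Fin N → ℝ, ((∀ i, b i ∈ Set.Icc (0:ℝ) 1) ∧ ∑ i, b i = M) →
          ∑ i, (q i * b i + q i * (1 - b i) * (1 - Real.exp (-nbar * b i)) * C)
            ≤ ∑ i, (q i * b₁ i + q i * (1 - b₁ i) * (1 - Real.exp (-nbar * b₁ i)) * C)) →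
        (∀ b : Fin N → ℝ, ((∀ i, b i ∈ Set.Icc (0:ℝ) 1) ∧ ∑ i, b i = M) →
          ∑ i, (q i * b i + q i * (1 - b i) * (1 - Real.exp (-nbar * b i)) * C)
            ≤ ∑ i, (q i * b₂ i + q i * (1 - b₂ i) * (1 - Real.exp (-nbar * b₂ i)) * C)) →
        b₁ = b₂ := by
  have hconc := strictConcaveOn_sum_pi fun i => strictConcaveOn_fileGain (hq i) hn hC
  refine ⟨hconc, ?_⟩
  rintro M - - b₁ b₂ ⟨hb₁, hs₁⟩ ⟨hb₂, hs₂⟩ hmax₁ hmax₂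
  have hconv : Convex ℝ {b : Fin N → ℝ | (∀ i, b i ∈ Set.Icc (0:ℝ) 1) ∧ ∑ i, b i = M} := by
    rintro x ⟨hx, hxs⟩ y ⟨hy, hys⟩ a b ha hb hab
    refine ⟨hconc.1 hx hy ha hb hab, ?_⟩
    simp only [Pi.add_apply, Pi.smul_apply, smul_eq_mul, Finset.sum_add_distrib,
      ← Finset.mul_sum, hxs, hys, ← add_mul, hab, one_mul]
  exact (hconc.subset (fun _ hb => hb.1) hconv).eq_of_isMaxOn
    (fun b hb => hmax₁ b hb) (fun b hb => hmax₂ b hb) ⟨hb₁, hs₁⟩ ⟨hb₂, hs₂⟩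
end

section
/- Let N be a positive integer, k ≥ 2 an integer, q₁,…,q_N ≥ 0, S₁,…,S_N ≥ 0, and a, c real constants with c ≥ a ≥ 0. Then the energy consumption E : ℝ^N → ℝ defined by E(b) = k·Σ_{i=1}^{N} q_i·S_i·[ a·((1 − b_i) − (1 − b_i)^k) + c·(1 − b_i)^k ] is convex on the box [0,1]^N. -/
/-- The energy consumption
`E(b) = k·Σ_i q_i·S_i·[a·((1−b_i) − (1−b_i)^k) + c·(1−b_i)^k]` is convex on `[0,1]^N`
when `c ≥ a ≥ 0`. -/
theorem stmt_6 (N k : ℕ) (hN : 0 < N) (hk : 2 ≤ k)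
    (q S : Fin N → ℝ) (hq : ∀ i, 0 ≤ q i) (hS : ∀ i, 0 ≤ S i)
    (a c : ℝ) (ha : 0 ≤ a) (hca : a ≤ c) :
    ConvexOn ℝ {b : Fin N → ℝ | ∀ i, b i ∈ Set.Icc (0:ℝ) 1}
      (fun b : Fin N → ℝ =>
        (k : ℝ) * ∑ i, q i * S i *
          (a * ((1 - b i) - (1 - b i) ^ k) + c * (1 - b i) ^ k)) := by
  refine ⟨fun x hx y hy s t hs ht hst i =>
    convex_Icc (0 : ℝ) 1 (hx i) (hy i) hs ht hst, fun x hx y hy s t hs ht hst => ?_⟩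
  have hterm : ∀ i, q i * S i *
      (a * ((1 - (s • x + t • y) i) - (1 - (s • x + t • y) i) ^ k)
        + c * (1 - (s • x + t • y) i) ^ k) ≤
      s * (q i * S i * (a * ((1 - x i) - (1 - x i) ^ k) + c * (1 - x i) ^ k)) +
      t * (q i * S i * (a * ((1 - y i) - (1 - y i) ^ k) + c * (1 - y i) ^ k)) := by
    intro i
    have hpow := (convexOn_pow (𝕜 := ℝ) k).2 (sub_nonneg.2 (hx i).2)
      (sub_nonneg.2 (hy i).2) hs ht hst
    have hcomb : 1 - (s • x + t • y) i = s * (1 - x i) + t * (1 - y i) := by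
      simp only [Pi.add_apply, Pi.smul_apply, smul_eq_mul]
      linear_combination -hst
    simp only [smul_eq_mul] at hpow
    rw [hcomb]
    have hmul := mul_le_mul_of_nonneg_left
      (mul_le_mul_of_nonneg_left hpow (sub_nonneg.2 hca)) (mul_nonneg (hq i) (hS i))
    linear_combination hmul
  have hsum := mul_le_mul_of_nonneg_left
    (Finset.sum_le_sum fun i (_ : i ∈ Finset.univ) => hterm i) (Nat.cast_nonneg (α := ℝ) k)
  rw [Finset.sum_add_distrib, ← Finset.mul_sum, ← Finset.mul_sum] at hsum
  simp only [smul_eq_mul]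
  linear_combination hsum
end

section
/- Let A, B > 0, O₁, O₂ > 0, ζ ≥ 0 and W > 0 be real constants with W > ζ·A/O₁ + ζ·B/O₂. Set ϖ = √(O₁·A/(O₂·B)) and w* = ( ζ·A + ϖ·(O₂·W − ζ·B) ) / ( O₁ + ϖ·O₂ ). Then w* satisfies O₁·w* > ζ·A and O₂·(W − w*) > ζ·B, and w* is the unique global minimizer of f(w) = A/(O₁·w − ζ·A) + B/(O₂·(W − w) − ζ·B) over the interval I = {w : O₁·w > ζ·A and O₂·(W − w) > ζ·B}. -/
/-- Second-order expansion of `c / x` around `a`, with exact remainder. -/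
lemma div_eq_tangent_add_remainder (c : ℝ) {a x : ℝ} (ha : 0 < a) (hx : 0 < x) :
    c / x = c / a - c * (x - a) / a ^ 2 + c * (x - a) ^ 2 / (a ^ 2 * x) := by
  field_simp
  ring


/-- The closed-form bandwidth allocation
`w* = (ζ·A + ϖ·(O₂·W − ζ·B)) / (O₁ + ϖ·O₂)` with `ϖ = √(O₁·A/(O₂·B))` lies in the
stability region and is the unique global minimizer of the weighted average delay there. -/
theorem stmt_10 (A B O₁ O₂ ζ W : ℝ) (hA : 0 < A) (hB : 0 < B)
    (hO₁ : 0 < O₁) (hO₂ : 0 < O₂) (hζ : 0 ≤ ζ) (hW : 0 < W)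
    (hfeas : ζ * A / O₁ + ζ * B / O₂ < W) :
    let ϖ : ℝ := Real.sqrt (O₁ * A / (O₂ * B))
    let wstar : ℝ := (ζ * A + ϖ * (O₂ * W - ζ * B)) / (O₁ + ϖ * O₂)
    let f : ℝ → ℝ := fun w => A / (O₁ * w - ζ * A) + B / (O₂ * (W - w) - ζ * B)
    (ζ * A < O₁ * wstar ∧ ζ * B < O₂ * (W - wstar)) ∧
    (∀ w : ℝ, ζ * A < O₁ * w → ζ * B < O₂ * (W - w) → f wstar ≤ f w) ∧
    (∀ w : ℝ, ζ * A < O₁ * w → ζ * B < O₂ * (W - w) → f w = f wstar → w = wstar) := by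
  intro ϖ wstar f
  have hϖ : 0 < ϖ := Real.sqrt_pos.2 (by positivity)
  have hϖ_sq : ϖ ^ 2 * (O₂ * B) = O₁ * A := by
    rw [Real.sq_sqrt (by positivity)]
    field_simp
  have hden : 0 < O₁ + ϖ * O₂ := by positivity
  have hwstar : wstar * (O₁ + ϖ * O₂) = ζ * A + ϖ * (O₂ * W - ζ * B) :=
    div_mul_cancel₀ _ hden.ne'
  have hslack : 0 < O₁ * O₂ * W - ζ * A * O₂ - ζ * B * O₁ := by
    rw [div_add_div _ _ hO₁.ne' hO₂.ne', div_lt_iff₀ (by positivity)] at hfeas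
    linarith
  have hratio : O₁ * wstar - ζ * A = ϖ * (O₂ * (W - wstar) - ζ * B) := by
    linear_combination hwstar
  have hy : 0 < O₂ * (W - wstar) - ζ * B := by
    have h : (O₂ * (W - wstar) - ζ * B) * (O₁ + ϖ * O₂) =
        O₁ * O₂ * W - ζ * A * O₂ - ζ * B * O₁ := by
      linear_combination -O₂ * hwstar
    exact pos_of_mul_pos_left (h ▸ hslack) hden.le
  have hx : 0 < O₁ * wstar - ζ * A := hratio ▸ mul_pos hϖ hy
  have hstationary : A * O₁ / (O₁ * wstar - ζ * A) ^ 2 =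
      B * O₂ / (O₂ * (W - wstar) - ζ * B) ^ 2 := by
    rw [div_eq_div_iff (by positivity) (by positivity), hratio]
    linear_combination -(O₂ * (W - wstar) - ζ * B) ^ 2 * hϖ_sq
  have hgap : ∀ w : ℝ, ζ * A < O₁ * w → ζ * B < O₂ * (W - w) →
      f w = f wstar +
        (A * (O₁ * (w - wstar)) ^ 2 / ((O₁ * wstar - ζ * A) ^ 2 * (O₁ * w - ζ * A)) +
          B * (O₂ * (w - wstar)) ^ 2 /
            ((O₂ * (W - wstar) - ζ * B) ^ 2 * (O₂ * (W - w) - ζ * B))) := by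
    intro w h₁ h₂
    have e₁ := div_eq_tangent_add_remainder A hx (sub_pos.2 h₁)
    have e₂ := div_eq_tangent_add_remainder B hy (sub_pos.2 h₂)
    simp only [f]
    linear_combination e₁ + e₂ - (w - wstar) * hstationary
  refine ⟨⟨sub_pos.1 hx, sub_pos.1 hy⟩, fun w h₁ h₂ => ?_, fun w h₁ h₂ heq => ?_⟩
  · have hw₁ := sub_pos.2 h₁
    have hw₂ := sub_pos.2 h₂
    rw [hgap w h₁ h₂]
    exact le_add_of_nonneg_right (by positivity)
  · have hw₁ := sub_pos.2 h₁
    have hw₂ := sub_pos.2 h₂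
    by_contra hne
    have hsub : w - wstar ≠ 0 := sub_ne_zero.2 hne
    refine (lt_add_of_pos_right (f wstar) ?_).ne' ((hgap w h₁ h₂).symm.trans heq)
    positivity
end
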